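/- Let m ≥ 2 be a positive integer, let ρ and ρ′ be two (possibly mixed) states on 2m qubits that are both local-Clifford equivalent to ρ^{[2m,2m−2,2]}, and let U ∈ U(2)^{⊗2m} be a local unitary operator such that U ρ U† = ρ′. Then U belongs to the local Clifford group 𝒞_{2m}ˡ. -/

import Mathlib

open Matrix

noncomputable section

/-- Pauli matrices: `0 ↦ σ₀` (identity), `1 ↦ σₓ`, `2 ↦ σ_y`, `3 ↦ σ_z`. -/
def pauliMat : Fin 4 → Matrix (Fin 2) (Fin 2) ℂ :=
  ![1, !![0, 1; 1, 0], !![0, -Complex.I; Complex.I, 0], !![1, 0; 0, -1]]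

/-- Tensor (Kronecker) product of a family of one-qubit operators, as an operator
on qubits indexed by `ι`. -/
def kron {ι : Type} [Fintype ι] (U : ι → Matrix (Fin 2) (Fin 2) ℂ) :
    Matrix (ι → Fin 2) (ι → Fin 2) ℂ :=
  Matrix.of fun x y => ∏ i, U i (x i) (y i)

/-- An element of the Pauli group: a phase in `{1, -1, i, -i}` together with a
Pauli label (`σ₀, σₓ, σ_y, σ_z`) on every qubit. -/
structure PauliOp (ι : Type) where
  phase : ℂ
  label : ι → Fin 4
  phase_ok : phase = 1 ∨ phase = -1 ∨ phase = Complex.I ∨ phase = -Complex.I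

noncomputable instance {ι : Type} : DecidableEq (PauliOp ι) := Classical.decEq _

/-- The matrix of a Pauli group element. -/
def PauliOp.toMatrix {ι : Type} [Fintype ι] (M : PauliOp ι) :
    Matrix (ι → Fin 2) (ι → Fin 2) ℂ :=
  M.phase • kron fun i => pauliMat (M.label i)

/-- The support of a Pauli operator: the set of qubits on which it acts nontrivially. -/
def PauliOp.support {ι : Type} [Fintype ι] [DecidableEq ι] (M : PauliOp ι) : Finset ι :=
  Finset.univ.filter fun i => M.label i ≠ 0

/-- A (maximal) stabilizer on the qubits indexed by `ι`: an abelian subgroup of the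
Pauli group of cardinality `2^|ι|` which does not contain `-I`. -/
structure Stabilizer (ι : Type) [Fintype ι] [DecidableEq ι] where
  elems : Finset (PauliOp ι)
  one_mem : ∃ M ∈ elems, PauliOp.toMatrix M = 1
  mul_mem : ∀ M ∈ elems, ∀ N ∈ elems, ∃ K ∈ elems,
    PauliOp.toMatrix K = PauliOp.toMatrix M * PauliOp.toMatrix N
  comm : ∀ M ∈ elems, ∀ N ∈ elems,
    PauliOp.toMatrix M * PauliOp.toMatrix N = PauliOp.toMatrix N * PauliOp.toMatrix M
  neg_one_not_mem : ∀ M ∈ elems, PauliOp.toMatrix M ≠ -1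
  card_elems : elems.card = 2 ^ Fintype.card ι

variable {ι : Type} [Fintype ι] [DecidableEq ι]

/-- `ψ` is the stabilizer state of the stabilizer `S`: it is a unit vector fixed by
every element of `S`. -/
def stabilizesState (S : Stabilizer ι) (ψ : (ι → Fin 2) → ℂ) : Prop :=
  (∑ x, Complex.normSq (ψ x)) = 1 ∧ ∀ M ∈ S.elems, (PauliOp.toMatrix M).mulVec ψ = ψ

/-- `ψ` is a stabilizer state. -/
def IsStabilizerState (ψ : (ι → Fin 2) → ℂ) : Prop :=
  ∃ S : Stabilizer ι, stabilizesState S ψ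

/-- `A_ω(ψ)`: the number of stabilizer elements with support exactly `ω`. -/
def Aomega (S : Stabilizer ι) (ω : Finset ι) : ℕ :=
  (S.elems.filter fun M => PauliOp.support M = ω).card

/-- `ω` is a minimal support of `S`: it is the support of some element of `S`, and no
element of `S` has nonempty support strictly contained in `ω`. -/
def IsMinimalSupport (S : Stabilizer ι) (ω : Finset ι) : Prop :=
  (∃ M ∈ S.elems, PauliOp.support M = ω) ∧
    ∀ M ∈ S.elems, PauliOp.support M ⊂ ω → PauliOp.support M = ∅

/-- The matrices of the minimal elements of `S` (the elements whose support is a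
minimal support). -/
def minimalMatrices (S : Stabilizer ι) : Set (Matrix (ι → Fin 2) (ι → Fin 2) ℂ) :=
  {A | ∃ M ∈ S.elems, IsMinimalSupport S (PauliOp.support M) ∧ PauliOp.toMatrix M = A}

/-- `M` belongs to the subgroup `ℳ(ψ)` of `S` generated by the minimal elements.
(Every stabilizer element is an involution, so the generated submonoid coincides with
the generated subgroup.) -/
def inMinimalSubgroup (S : Stabilizer ι) (M : PauliOp ι) : Prop :=
  M ∈ S.elems ∧ PauliOp.toMatrix M ∈ Submonoid.closure (minimalMatrices S)

/-- A one-qubit Clifford operation: a unitary mapping each of the three Pauli matrices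
to a Pauli matrix, up to sign, under conjugation. -/
def IsClifford (U : Matrix (Fin 2) (Fin 2) ℂ) : Prop :=
  U ∈ Matrix.unitaryGroup (Fin 2) ℂ ∧
    ∃ π : Equiv.Perm (Fin 3), ∀ u : Fin 3, ∃ s : ℂ, (s = 1 ∨ s = -1) ∧
      U * pauliMat u.succ * Uᴴ = s • pauliMat (π u).succ

/-- Local unitary equivalence of pure states. -/
def LUequiv (ψ φ : (ι → Fin 2) → ℂ) : Prop :=
  ∃ U : ι → Matrix (Fin 2) (Fin 2) ℂ,
    (∀ i, U i ∈ Matrix.unitaryGroup (Fin 2) ℂ) ∧ (kron U).mulVec ψ = φ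

/-- Local Clifford equivalence of pure states. -/
def LCequiv (ψ φ : (ι → Fin 2) → ℂ) : Prop :=
  ∃ U : ι → Matrix (Fin 2) (Fin 2) ℂ,
    (∀ i, IsClifford (U i)) ∧ (kron U).mulVec ψ = φ

/-- Local Clifford equivalence of (possibly mixed) states. -/
def LCequivMixed (ρ ρ' : Matrix (ι → Fin 2) (ι → Fin 2) ℂ) : Prop :=
  ∃ U : ι → Matrix (Fin 2) (Fin 2) ℂ,
    (∀ i, IsClifford (U i)) ∧ kron U * ρ * (kron U)ᴴ = ρ'

/-- A pure state is fully entangled if it is not a tensor product of states on two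
complementary nonempty subsets of the qubits. -/
def FullyEntangled (ψ : (ι → Fin 2) → ℂ) : Prop :=
  ¬ ∃ (ω : Finset ι) (φ : ({i // i ∈ ω} → Fin 2) → ℂ) (χ : ({i // i ∉ ω} → Fin 2) → ℂ),
      ω ≠ ∅ ∧ ω ≠ Finset.univ ∧
        ∀ x : ι → Fin 2, ψ x = φ (fun i => x i.1) * χ (fun i => x i.1)

/-- Recombine an assignment on `ω` and one on its complement into a global assignment. -/
def mergeAssign (ω : Finset ι) (x : {i // i ∈ ω} → Fin 2) (z : {i // i ∉ ω} → Fin 2) :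
    ι → Fin 2 :=
  fun i => if h : i ∈ ω then x ⟨i, h⟩ else z ⟨i, h⟩

/-- The reduced density matrix `ρ_ω(ψ)` of the pure state `ψ` on the qubits in `ω`
(partial trace of `|ψ⟩⟨ψ|` over the qubits outside `ω`). -/
def reducedState (ψ : (ι → Fin 2) → ℂ) (ω : Finset ι) :
    Matrix ({i // i ∈ ω} → Fin 2) ({i // i ∈ ω} → Fin 2) ℂ :=
  Matrix.of fun x y =>
    ∑ z : {i // i ∉ ω} → Fin 2, ψ (mergeAssign ω x z) * (starRingEnd ℂ) (ψ (mergeAssign ω y z))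

/-- The restriction `α_M M_{i₁} ⊗ ⋯ ⊗ M_{i_k}` of a Pauli operator to the qubits in `ω`. -/
def PauliOp.restrict (M : PauliOp ι) (ω : Finset ι) :
    Matrix ({i // i ∈ ω} → Fin 2) ({i // i ∈ ω} → Fin 2) ℂ :=
  M.phase • kron fun i : {i // i ∈ ω} => pauliMat (M.label i.1)

/-- The `n`-qubit GHZ state `(|0…0⟩ + |1…1⟩)/√2`. -/
def ghz (n : ℕ) : (Fin n → Fin 2) → ℂ :=
  fun x => if x = (fun _ => 0) ∨ x = (fun _ => 1) then ((Real.sqrt 2 : ℝ)⁻¹ : ℂ) else 0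

/-- The `2n × 2n` binary symplectic form `P = [[0, I], [I, 0]]`. -/
def Pmat (n : ℕ) : Matrix (Fin n ⊕ Fin n) (Fin n ⊕ Fin n) (ZMod 2) :=
  Matrix.fromBlocks 0 1 1 0

end

/-- The state `ρ^{[2m, 2m-2, 2]}` on `2m` qubits. -/
noncomputable def rhoStd (m : ℕ) : Matrix (Fin (2 * m) → Fin 2) (Fin (2 * m) → Fin 2) ℂ :=
  ((2 : ℂ) ^ (2 * m))⁻¹ •
    (1 + kron (fun _ => pauliMat 1) + ((-1 : ℂ) ^ m) • kron (fun _ => pauliMat 2)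
      + kron (fun _ => pauliMat 3))

section KroneckerProducts

variable {ι : Type} [Fintype ι]

theorem kron_mul_kron [DecidableEq ι] (A B : ι → Matrix (Fin 2) (Fin 2) ℂ) :
    kron A * kron B = kron fun i => A i * B i := by
  ext x y
  simp only [kron, Matrix.mul_apply, Matrix.of_apply, ← Finset.prod_mul_distrib]
  rw [Finset.prod_univ_sum, Fintype.piFinset_univ]

theorem conjTranspose_kron (A : ι → Matrix (Fin 2) (Fin 2) ℂ) :
    (kron A)ᴴ = kron fun i => (A i)ᴴ := by
  ext x y
  simp [kron, Matrix.conjTranspose_apply]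

theorem kron_one [DecidableEq ι] :
    kron (fun _ : ι => (1 : Matrix (Fin 2) (Fin 2) ℂ)) = 1 := by
  ext x y
  simp only [kron, Matrix.of_apply, Matrix.one_apply, Finset.prod_ite_zero, Finset.prod_const_one]
  simp [funext_iff]

theorem trace_kron [DecidableEq ι] (A : ι → Matrix (Fin 2) (Fin 2) ℂ) :
    (kron A).trace = ∏ i, (A i).trace := by
  simp only [kron, Matrix.trace, Matrix.diag_apply, Matrix.of_apply]
  rw [Finset.prod_univ_sum, Fintype.piFinset_univ]

end KroneckerProducts

section Pauli

theorem pauliMat_succ_mul_self (a : Fin 3) : pauliMat a.succ * pauliMat a.succ = 1 := by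
  ext i j
  fin_cases a <;> fin_cases i <;> fin_cases j <;> simp [pauliMat, Matrix.mul_apply]

theorem trace_pauliMat_mul (a b : Fin 3) :
    (pauliMat a.succ * pauliMat b.succ).trace = if a = b then 2 else 0 := by
  fin_cases a <;> fin_cases b <;>
    simp [pauliMat, Matrix.trace, Fin.sum_univ_two] <;> norm_num

theorem trace_pauliMat_succ (a : Fin 3) : (pauliMat a.succ).trace = 0 := by
  fin_cases a <;> simp [pauliMat, Matrix.trace, Fin.sum_univ_two]

theorem eq_sum_trace_smul_pauliMat {A : Matrix (Fin 2) (Fin 2) ℂ} (hA : A.trace = 0) :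
    A = ∑ a : Fin 3, ((pauliMat a.succ * A).trace / 2) • pauliMat a.succ := by
  have h : A 1 1 = -A 0 0 := by
    rw [Matrix.trace_fin_two] at hA
    linear_combination hA
  ext i j
  fin_cases i <;> fin_cases j <;>
    simp [pauliMat, Fin.sum_univ_three, Matrix.trace_fin_two, Matrix.mul_apply, h] <;>
    ring_nf <;> simp only [Complex.I_sq] <;> ring

theorem eq_of_pauliMat_eq_smul {a b : Fin 3} {s : ℂ}
    (h : pauliMat a.succ = s • pauliMat b.succ) : a = b := by
  by_contra hab
  have := congrArg (fun A => (pauliMat a.succ * A).trace) h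
  simp [trace_pauliMat_mul, hab] at this

end Pauli

namespace IsClifford

variable {U V : Matrix (Fin 2) (Fin 2) ℂ}

theorem of_forall_exists (hU : U ∈ Matrix.unitaryGroup (Fin 2) ℂ)
    (h : ∀ u : Fin 3, ∃ (v : Fin 3) (s : ℂ), (s = 1 ∨ s = -1) ∧
      U * pauliMat u.succ * Uᴴ = s • pauliMat v.succ) : IsClifford U := by
  choose f s hs hf using h
  have hUU : Uᴴ * U = 1 := Matrix.mem_unitaryGroup_iff'.mp hU
  have key : ∀ u, pauliMat u.succ = s u • (Uᴴ * pauliMat (f u).succ * U) := fun u => by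
    calc pauliMat u.succ = (Uᴴ * U) * pauliMat u.succ * (Uᴴ * U) := by simp [hUU]
      _ = Uᴴ * (U * pauliMat u.succ * Uᴴ) * U := by simp only [Matrix.mul_assoc]
      _ = _ := by rw [hf]; simp
  have hinj : Function.Injective f := fun u v huv => by
    refine eq_of_pauliMat_eq_smul (s := s u * s v) ?_
    rw [key u, key v, huv, smul_smul, mul_assoc]
    rcases hs v with h | h <;> simp [h]
  refine ⟨hU, Equiv.ofBijective f (Finite.injective_iff_bijective.mp hinj), fun u => ?_⟩
  exact ⟨s u, hs u, hf u⟩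

theorem mul (hU : IsClifford U) (hV : IsClifford V) : IsClifford (U * V) := by
  obtain ⟨hU, π, hπ⟩ := hU
  obtain ⟨hV, τ, hτ⟩ := hV
  refine of_forall_exists (mul_mem hU hV) fun u => ?_
  obtain ⟨s, hs, hsu⟩ := hτ u
  obtain ⟨t, ht, htu⟩ := hπ (τ u)
  refine ⟨π (τ u), s * t, ?_, ?_⟩
  · rcases hs with rfl | rfl <;> rcases ht with rfl | rfl <;> simp
  · calc U * V * pauliMat u.succ * (U * V)ᴴ = U * (V * pauliMat u.succ * Vᴴ) * Uᴴ := by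
          simp only [Matrix.conjTranspose_mul, Matrix.mul_assoc]
      _ = _ := by rw [hsu, Matrix.mul_smul, Matrix.smul_mul, htu, smul_smul]

theorem conjTranspose (hU : IsClifford U) : IsClifford Uᴴ := by
  obtain ⟨hU, π, hπ⟩ := hU
  have hUU : Uᴴ * U = 1 := Matrix.mem_unitaryGroup_iff'.mp hU
  refine of_forall_exists (Unitary.star_mem hU) fun u => ?_
  obtain ⟨s, hs, hsu⟩ := hπ (π.symm u)
  rw [Equiv.apply_symm_apply] at hsu
  refine ⟨π.symm u, s, hs, ?_⟩
  have hss : s * s = 1 := by rcases hs with rfl | rfl <;> simp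
  have hu : pauliMat u.succ = s • (U * pauliMat (π.symm u).succ * Uᴴ) := by
    rw [hsu, smul_smul, hss, one_smul]
  rw [hu, Matrix.conjTranspose_conjTranspose, Matrix.mul_smul, Matrix.smul_mul]
  congr 1
  calc Uᴴ * (U * pauliMat (π.symm u).succ * Uᴴ) * U
      = (Uᴴ * U) * pauliMat (π.symm u).succ * (Uᴴ * U) := by simp only [Matrix.mul_assoc]
    _ = _ := by simp [hUU]

/-- A unitary whose adjoint-representation matrix has at most one nonzero entry in each row is
Clifford. -/
theorem of_trace_mul_trace_eq_zero (hU : U ∈ Matrix.unitaryGroup (Fin 2) ℂ)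
    (h : ∀ b a a' : Fin 3, a ≠ a' →
      (pauliMat b.succ * (U * pauliMat a.succ * Uᴴ)).trace *
        (pauliMat b.succ * (U * pauliMat a'.succ * Uᴴ)).trace = 0) : IsClifford U := by
  have hUU : U * Uᴴ = 1 := Matrix.mem_unitaryGroup_iff.mp hU
  have hUhU : Uᴴ * U = 1 := Matrix.mem_unitaryGroup_iff'.mp hU
  suffices IsClifford Uᴴ by simpa using this.conjTranspose
  refine of_forall_exists (Unitary.star_mem hU) fun b => ?_
  rw [Matrix.conjTranspose_conjTranspose]
  set E := Uᴴ * pauliMat b.succ * U with hE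
  have htr : ∀ a : Fin 3, (pauliMat b.succ * (U * pauliMat a.succ * Uᴴ)).trace =
      (pauliMat a.succ * E).trace := fun a => by
    rw [Matrix.trace_mul_comm (pauliMat a.succ), hE, Matrix.mul_assoc Uᴴ, Matrix.mul_assoc Uᴴ,
      Matrix.trace_mul_comm Uᴴ]
    simp only [Matrix.mul_assoc]
  have hb := h b
  simp only [htr] at hb
  have hE0 : E.trace = 0 := by
    rw [hE, Matrix.trace_mul_comm, ← Matrix.mul_assoc, hUU, one_mul, trace_pauliMat_succ]
  have hEE : E * E = 1 := by
    calc E * E = Uᴴ * (pauliMat b.succ * (U * Uᴴ) * pauliMat b.succ) * U := by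
          simp only [hE, Matrix.mul_assoc]
      _ = 1 := by rw [hUU, Matrix.mul_one, pauliMat_succ_mul_self, Matrix.mul_one, hUhU]
  obtain ⟨a, ha⟩ : ∃ a : Fin 3, (pauliMat a.succ * E).trace ≠ 0 := by
    by_contra! hcon
    have : E = 0 := by rw [eq_sum_trace_smul_pauliMat hE0]; simp [hcon]
    simp [this] at hEE
  have hEa : E = ((pauliMat a.succ * E).trace / 2) • pauliMat a.succ := by
    conv_lhs => rw [eq_sum_trace_smul_pauliMat hE0]
    refine Finset.sum_eq_single a (fun a' _ haa' => ?_) (by simp)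
    rw [(mul_eq_zero.mp (hb a a' haa'.symm)).resolve_left ha, zero_div, zero_smul]
  refine ⟨a, _, ?_, hEa⟩
  rw [hEa, Matrix.smul_mul, Matrix.mul_smul, smul_smul, pauliMat_succ_mul_self] at hEE
  have := congrFun (congrFun hEE 0) 0
  rw [← mul_self_eq_one_iff]
  simpa only [Matrix.smul_apply, Matrix.one_apply_eq, smul_eq_mul, mul_one] using this

end IsClifford

section DiagonalPauliTensor

variable {ι : Type} [Fintype ι] [DecidableEq ι]

theorem trace_conj_sum_mul_kron (c : Fin 3 → ℂ) (T X : ι → Matrix (Fin 2) (Fin 2) ℂ) :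
    (kron T * (∑ a, c a • kron fun _ => pauliMat a.succ) * (kron T)ᴴ * kron X).trace =
      ∑ a, c a * ∏ i, (T i * pauliMat a.succ * (T i)ᴴ * X i).trace := by
  simp only [conjTranspose_kron, Matrix.mul_sum, Matrix.sum_mul, Matrix.mul_smul, Matrix.smul_mul,
    Matrix.trace_sum, Matrix.trace_smul, kron_mul_kron, trace_kron, smul_eq_mul]

theorem trace_sum_mul_kron (c : Fin 3 → ℂ) (X : ι → Matrix (Fin 2) (Fin 2) ℂ) :
    ((∑ a, c a • kron fun _ => pauliMat a.succ) * kron X).trace =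
      ∑ a, c a * ∏ i, (pauliMat a.succ * X i).trace := by
  simp only [Matrix.sum_mul, Matrix.smul_mul,
    Matrix.trace_sum, Matrix.trace_smul, kron_mul_kron, trace_kron, smul_eq_mul]

variable {c : Fin 3 → ℂ} {T : ι → Matrix (Fin 2) (Fin 2) ℂ}

theorem sum_trace_mul_prod_erase (hT : ∀ i, T i ∈ Matrix.unitaryGroup (Fin 2) ℂ)
    (h : kron T * (∑ a, c a • kron fun _ => pauliMat a.succ) * (kron T)ᴴ =
      ∑ a, c a • kron fun _ => pauliMat a.succ) (i : ι) (b : Fin 3) (f : ι → Fin 3) :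
    ∑ a, c a * ((pauliMat b.succ * (T i * pauliMat a.succ * (T i)ᴴ)).trace *
        ∏ j ∈ Finset.univ.erase i, if a = f j then 2 else 0) =
      c b * (2 * ∏ j ∈ Finset.univ.erase i,
        (pauliMat b.succ * (T j * pauliMat (f j).succ * (T j)ᴴ)).trace) := by
  set X : ι → Matrix (Fin 2) (Fin 2) ℂ :=
    Function.update (fun j => T j * pauliMat (f j).succ * (T j)ᴴ) i (pauliMat b.succ)
  have hX := congrArg (fun A => (A * kron X).trace) h
  simp only [trace_conj_sum_mul_kron, trace_sum_mul_kron] at hX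
  have hXi : X i = pauliMat b.succ := Function.update_self ..
  have hXj : ∀ j ∈ Finset.univ.erase i, X j = T j * pauliMat (f j).succ * (T j)ᴴ :=
    fun j hj => Function.update_of_ne (Finset.ne_of_mem_erase hj) _ _
  have hconj : ∀ (j : ι) (a a' : Fin 3),
      (T j * pauliMat a.succ * (T j)ᴴ * (T j * pauliMat a'.succ * (T j)ᴴ)).trace =
        if a = a' then 2 else 0 := fun j a a' => by
    have hj : (T j)ᴴ * T j = 1 := Matrix.mem_unitaryGroup_iff'.mp (hT j)
    calc _ = (T j * (pauliMat a.succ * ((T j)ᴴ * T j) * pauliMat a'.succ * (T j)ᴴ)).trace := by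
          simp only [Matrix.mul_assoc]
      _ = _ := by
          rw [Matrix.trace_mul_comm, hj, Matrix.mul_assoc _ _ (T j), hj, Matrix.mul_one,
            Matrix.mul_one, trace_pauliMat_mul]
  have hl : ∀ a : Fin 3, ∏ j, (T j * pauliMat a.succ * (T j)ᴴ * X j).trace =
      (pauliMat b.succ * (T i * pauliMat a.succ * (T i)ᴴ)).trace *
        ∏ j ∈ Finset.univ.erase i, if a = f j then 2 else 0 := fun a => by
    rw [← Finset.mul_prod_erase _ _ (Finset.mem_univ i), hXi, Matrix.trace_mul_comm]
    congr 1
    exact Finset.prod_congr rfl fun j hj => by rw [hXj j hj, hconj]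
  simp only [hl] at hX
  rw [hX, Finset.sum_eq_single b]
  · rw [← Finset.mul_prod_erase _ _ (Finset.mem_univ i), hXi, trace_pauliMat_mul, if_pos rfl]
    congr 2
    exact Finset.prod_congr rfl fun j hj => by rw [hXj j hj]
  · intro a _ hab
    rw [← Finset.mul_prod_erase _ _ (Finset.mem_univ i), hXi, trace_pauliMat_mul, if_neg hab]
    simp
  · simp

/-- On at least three qubits, a local unitary fixing a nondegenerate diagonal combination of
Pauli tensors is local Clifford. -/
theorem isClifford_of_conj_sum_eq (hι : 3 ≤ Fintype.card ι) (hc : ∀ a, c a ≠ 0)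
    (hT : ∀ i, T i ∈ Matrix.unitaryGroup (Fin 2) ℂ)
    (h : kron T * (∑ a, c a • kron fun _ => pauliMat a.succ) * (kron T)ᴴ =
      ∑ a, c a • kron fun _ => pauliMat a.succ) (i : ι) : IsClifford (T i) := by
  obtain ⟨k, hk, l, hl, hkl⟩ : ∃ k ∈ Finset.univ.erase i, ∃ l ∈ Finset.univ.erase i, k ≠ l := by
    refine Finset.one_lt_card.mp ?_
    rw [Finset.card_erase_of_mem (Finset.mem_univ i), Finset.card_univ]
    lia
  refine IsClifford.of_trace_mul_trace_eq_zero (hT i) fun b a a' haa' => ?_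
  set r : ι → Fin 3 → ℂ := fun j a => (pauliMat b.succ * (T j * pauliMat a.succ * (T j)ᴴ)).trace
  have hdiag : ∀ d, c d * (r i d * 2 ^ (Finset.univ.erase i).card) =
      c b * (2 * ∏ j ∈ Finset.univ.erase i, r j d) := fun d => by
    rw [← sum_trace_mul_prod_erase hT h i b fun _ => d, Finset.sum_eq_single d]
    · simp [r]
    · intro e _ hed
      rw [Finset.prod_eq_zero hk (if_neg hed)]
      simp
    · simp
  have hoff : ∏ j ∈ Finset.univ.erase i, r j (if j = k then a' else a) = 0 := by
    have := sum_trace_mul_prod_erase hT h i b fun j => if j = k then a' else a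
    rw [Finset.sum_eq_zero] at this
    · simpa [hc b, r] using this.symm
    · intro e _
      by_cases he : e = a
      · rw [Finset.prod_eq_zero hk (by simp [he, haa'])]
        simp
      · rw [Finset.prod_eq_zero hl (by simp [he, hkl.symm])]
        simp
  have hzero : (∏ j ∈ Finset.univ.erase i, r j a) * ∏ j ∈ Finset.univ.erase i, r j a' = 0 := by
    obtain ⟨j, hj, hj0⟩ := Finset.prod_eq_zero_iff.mp hoff
    split_ifs at hj0
    · exact mul_eq_zero_of_right _ (Finset.prod_eq_zero (f := fun j => r j a') hj hj0)
    · exact mul_eq_zero_of_left (Finset.prod_eq_zero (f := fun j => r j a) hj hj0) _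
  change r i a * r i a' = 0
  have hri : ∀ d, ∏ j ∈ Finset.univ.erase i, r j d = 0 → r i d = 0 := fun d h0 => by
    have hd := hdiag d
    rw [h0, mul_zero, mul_zero] at hd
    exact (mul_eq_zero.mp ((mul_eq_zero.mp hd).resolve_left (hc d))).resolve_right
      (pow_ne_zero _ two_ne_zero)
  rcases mul_eq_zero.mp hzero with h0 | h0
  · rw [hri a h0, zero_mul]
  · rw [hri a' h0, mul_zero]

end DiagonalPauliTensor

theorem rhoStd_eq_smul_one_add_sum (m : ℕ) :
    rhoStd m = ((2 : ℂ) ^ (2 * m))⁻¹ •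
      (1 + ∑ a : Fin 3, (![1, (-1) ^ m, 1] : Fin 3 → ℂ) a • kron fun _ => pauliMat a.succ) := by
  simp [rhoStd, Fin.sum_univ_three, add_assoc]

/-- If `ρ, ρ'` are states on `2m` qubits (`m ≥ 2`) both local Clifford
equivalent to `ρ^{[2m, 2m-2, 2]}`, then any local unitary mapping `ρ` to `ρ'` is a local
Clifford operation. -/
theorem stmt_2 {m : ℕ} (hm : 2 ≤ m)
    (ρ ρ' : Matrix (Fin (2 * m) → Fin 2) (Fin (2 * m) → Fin 2) ℂ)
    (hρ : LCequivMixed (rhoStd m) ρ) (hρ' : LCequivMixed (rhoStd m) ρ')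
    (U : Fin (2 * m) → Matrix (Fin 2) (Fin 2) ℂ)
    (hU : ∀ i, U i ∈ Matrix.unitaryGroup (Fin 2) ℂ)
    (hmap : kron U * ρ * (kron U)ᴴ = ρ') :
    ∀ i, IsClifford (U i) := by
  obtain ⟨V, hV, rfl⟩ := hρ
  obtain ⟨W, hW, rfl⟩ := hρ'
  have hVV : ∀ i, V i * (V i)ᴴ = 1 := fun i => Matrix.mem_unitaryGroup_iff.mp (hV i).1
  have hWW : ∀ i, W i * (W i)ᴴ = 1 := fun i => Matrix.mem_unitaryGroup_iff.mp (hW i).1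
  have hWW' : ∀ i, (W i)ᴴ * W i = 1 := fun i => Matrix.mem_unitaryGroup_iff'.mp (hW i).1
  set T : Fin (2 * m) → Matrix (Fin 2) (Fin 2) ℂ := fun i => (W i)ᴴ * (U i * V i)
  have hT : ∀ i, T i ∈ Matrix.unitaryGroup (Fin 2) ℂ := fun i =>
    mul_mem (Unitary.star_mem (hW i).1) (mul_mem (hU i) (hV i).1)
  have hkT : kron T = (kron W)ᴴ * (kron U * kron V) := by
    simp only [conjTranspose_kron, kron_mul_kron, T]
  have hkW : (kron W)ᴴ * kron W = 1 := by
    simp only [conjTranspose_kron, kron_mul_kron, hWW', kron_one]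
  have hkT1 : kron T * (kron T)ᴴ = 1 := by
    have hTT : ∀ i, T i * (T i)ᴴ = 1 := fun i => Matrix.mem_unitaryGroup_iff.mp (hT i)
    simp only [conjTranspose_kron, kron_mul_kron, hTT, kron_one]
  have hfix : kron T * rhoStd m * (kron T)ᴴ = rhoStd m := by
    calc kron T * rhoStd m * (kron T)ᴴ
        = (kron W)ᴴ * (kron U * (kron V * rhoStd m * (kron V)ᴴ) * (kron U)ᴴ) * kron W := by
          simp only [hkT, Matrix.conjTranspose_mul, Matrix.conjTranspose_conjTranspose,
            Matrix.mul_assoc]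
      _ = (kron W)ᴴ * kron W * rhoStd m * ((kron W)ᴴ * kron W) := by
          rw [hmap]
          simp only [Matrix.mul_assoc]
      _ = rhoStd m := by rw [hkW, Matrix.one_mul, Matrix.mul_one]
  rw [rhoStd_eq_smul_one_add_sum, Matrix.mul_smul, Matrix.smul_mul, Matrix.mul_add,
    Matrix.add_mul, Matrix.mul_one, hkT1] at hfix
  have hsum := add_left_cancel (smul_right_injective _ (inv_ne_zero (by simp)) hfix)
  intro i
  have hTi : IsClifford (T i) := by
    refine isClifford_of_conj_sum_eq (by rw [Fintype.card_fin]; lia) (fun a => ?_) hT hsum i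
    fin_cases a <;> simp
  have hUi : U i = W i * T i * (V i)ᴴ := by
    calc U i = (W i * (W i)ᴴ) * U i * (V i * (V i)ᴴ) := by simp [hVV, hWW]
      _ = _ := by simp only [T, Matrix.mul_assoc]
  rw [hUi]
  exact ((hW i).mul hTi).mul (hV i).conjTranspose
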